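/- Let $A$ be an irreducible algebraic variety over an algebraically closed field $K$ equipped with regular maps $\alpha, \mu : A \times A \to A$ satisfying all the algebraic-ring axioms (I)-(IV), including the existence of a multiplicative identity $1_A$. Then the underlying variety $A$ is affine. -/

import Mathlib

open CategoryTheory Limits AlgebraicGeometry

noncomputable section

/-- Given a scheme `X` over a base `S` (via `s : X ⟶ S`) and a binary operation
`μ : X ×_S X ⟶ X`, the induced operation on `T`-valued points `x, y : T ⟶ X`
lying over a common map to `S`. -/
def ptOp {X S : Scheme} (s : X ⟶ S) (μ : pullback s s ⟶ X)
    {T : Scheme} (x y : T ⟶ X) (h : x ≫ s = y ≫ s) : T ⟶ X :=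
  pullback.lift x y h ≫ μ

end


lemma aux_isField (K : Type) [Field K] : IsField Γ(Spec (CommRingCat.of K), ⊤) :=
  MulEquiv.isField (Field.toIsField K) (Scheme.ΓSpecIso (.of K)).commRingCatIsoToRingEquiv.toMulEquiv

lemma aux_fb (K : Type) [Field K] {X T : Scheme} (s : X ⟶ Spec (CommRingCat.of K))
    (t : T ⟶ Spec (CommRingCat.of K)) [QuasiCompact s] [QuasiSeparated s] [QuasiCompact t]
    [QuasiSeparated t] :
    IsPushout s.appTop t.appTop (pullback.fst s t).appTop (pullback.snd s t).appTop := by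
  have hs : CompactSpace X := QuasiCompact.compactSpace_of_compactSpace s
  have ht : CompactSpace T := QuasiCompact.compactSpace_of_compactSpace t
  have hs' : QuasiSeparatedSpace X := quasiSeparatedSpace_of_quasiSeparated s
  have ht' : QuasiSeparatedSpace T := quasiSeparatedSpace_of_quasiSeparated t
  have hfl : (CommRingCat.Hom.hom (Scheme.Hom.appLE s ⊤ ⊤ le_top)).Flat := by
    let := (aux_isField K).toField
    let := (CommRingCat.Hom.hom (Scheme.Hom.appLE s ⊤ ⊤ le_top)).toAlgebra
    change Module.Flat Γ(Spec (CommRingCat.of K), ⊤) Γ(X, ⊤)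
    infer_instance
  have := isIso_pushoutSection_of_isCompact_of_flat_right_of_ringHomFlat
    (IsPullback.of_hasPullback s t) (US := ⊤) (UT := ⊤) (UX := ⊤) (UY := ⊤) le_top le_top
    (by simp) (isAffineOpen_top _) isCompact_univ
    isQuasiSeparated_univ isCompact_univ
    isQuasiSeparated_univ hfl
  have := (isIso_pushoutSection_iff ..).mp this
  simpa [Scheme.Hom.appTop, Scheme.Hom.app_eq_appLE] using this

lemma aux_sum {R A B C : CommRingCat.{0}} {f : R ⟶ A} {g : R ⟶ B} {h : A ⟶ C} {i : B ⟶ C}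
    (H : IsPushout f g h i) (c : C) :
    ∃ S : Finset (A × B), c = ∑ p ∈ S, h.hom p.1 * i.hom p.2 := by
  let := f.hom.toAlgebra
  let := g.hom.toAlgebra
  have H' := CommRingCat.isPushout_tensorProduct R A B
  let e : CommRingCat.of (TensorProduct R A B) ≅ C := H'.isoIsPushout _ _ H
  obtain ⟨S, hS⟩ := TensorProduct.exists_finset (e.inv.hom c : TensorProduct R A B)
  refine ⟨S, ?_⟩
  have h1 : c = e.hom.hom (e.inv.hom c) := by simp
  have hl : ∀ a, e.hom.hom (a ⊗ₜ[R] (1 : B)) = h.hom a := fun a ↦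
    congr(($(H'.inl_isoIsPushout_hom _ _ H)).hom a)
  have hr : ∀ b, e.hom.hom ((1 : A) ⊗ₜ[R] b) = i.hom b := fun b ↦
    congr(($(H'.inr_isoIsPushout_hom _ _ H)).hom b)
  rw [h1, hS]
  refine (map_sum e.hom.hom _ _).trans (Finset.sum_congr rfl fun p _ ↦ ?_)
  rw [← hl, ← hr]
  refine Eq.trans ?_ (map_mul e.hom.hom _ _)
  congr 1
  exact (by simp : p.1 ⊗ₜ[R] p.2 = (p.1 ⊗ₜ[R] (1 : B)) * ((1 : A) ⊗ₜ[R] p.2))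

lemma aux_alg0 {k M A I : Type*} [Field k] [CommRing A] [Algebra k A] [AddCommGroup M] [Module k M]
    (ev : I → A →ₗ[k] k) (hev : ∀ a, (∀ i, ev i a = 0) → a = 0)
    (w : TensorProduct k M A) (h : ∀ i, (ev i).lTensor M w = 0) : w = 0 := by
  classical
  let b := Module.Basis.ofVectorSpace k M
  apply (TensorProduct.equivFinsuppOfBasisLeft (N := A) b).injective
  rw [map_zero]
  ext j
  apply hev
  intro i
  have : ∀ w : TensorProduct k M A, ev i ((TensorProduct.equivFinsuppOfBasisLeft (N := A) b w) j) =
      (TensorProduct.equivFinsuppOfBasisLeft (N := k) b ((ev i).lTensor M w)) j := by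
    intro w
    induction w with
    | zero => simp
    | add x y hx hy => simp [hx, hy]
    | tmul m a => simp [TensorProduct.equivFinsuppOfBasisLeft_apply_tmul_apply]
  rw [this, h]; simp

lemma aux_alg {k A I : Type*} [Field k] [CommRing A] (f : k →+* A)
    (ev : I → A →+* k) (hf : ∀ i x, ev i (f x) = x) (hev : ∀ a, (∀ i, ev i a = 0) → a = 0)
    (J : Ideal A) (S : Finset (A × A)) (h : ∀ i, ∑ p ∈ S, p.1 * f (ev i p.2) ∈ J)
    (θ : A →+* A) (hθ : ∀ x, θ (f x) = f x) : ∑ p ∈ S, p.1 * θ p.2 ∈ J := by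
  let := f.toAlgebra
  let ev' : I → A →ₐ[k] k := fun i ↦ { ev i with commutes' := hf i }
  let θ' : A →ₐ[k] A := { θ with commutes' := hθ }
  let w : TensorProduct k (A ⧸ J) A := ∑ p ∈ S, (Ideal.Quotient.mk J p.1) ⊗ₜ[k] p.2
  have hw : w = 0 := by
    apply aux_alg0 (fun i ↦ (ev' i).toLinearMap) hev
    intro i
    apply (TensorProduct.rid k (A ⧸ J)).injective
    rw [map_zero, ← Ideal.Quotient.eq_zero_iff_mem.mpr (h i)]
    simp only [w, map_sum, LinearMap.lTensor_tmul, TensorProduct.rid_tmul, map_mul]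
    refine Finset.sum_congr rfl fun p _ ↦ ?_
    rw [Algebra.smul_def, mul_comm]
    rfl
  rw [← Ideal.Quotient.eq_zero_iff_mem]
  have := congr(Algebra.TensorProduct.productMap (AlgHom.id k (A ⧸ J)) ((Ideal.Quotient.mkₐ k J).comp θ') $hw)
  rw [map_zero] at this
  rw [← this]
  simp [w, map_sum, θ']

lemma aux_pt (K : Type) [Field K] [IsAlgClosed K] {X : Scheme} (s : X ⟶ Spec (CommRingCat.of K))
    [LocallyOfFiniteType s] (x : X) (hx : IsClosed {x}) :
    ∃ t : Spec (CommRingCat.of K) ⟶ X, t ≫ s = 𝟙 _ ∧ ∀ p, t p = x :=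
  ⟨pointOfClosedPoint s x hx, pointOfClosedPoint_comp s x hx,
    fun p ↦ pointOfClosedPoint_apply s x hx p⟩

lemma aux_ptU (K : Type) [Field K] [IsAlgClosed K] {X : Scheme} (s : X ⟶ Spec (CommRingCat.of K))
    [LocallyOfFiniteType s] (U : X.Opens) (hU : U ≠ ⊥) :
    ∃ t : Spec (CommRingCat.of K) ⟶ X, t ≫ s = 𝟙 _ ∧ ∀ p, t p ∈ U := by
  have := LocallyOfFiniteType.jacobsonSpace s
  have hne : (U : Set X).Nonempty := by
    rw [Set.nonempty_iff_ne_empty]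
    intro h
    exact hU (TopologicalSpace.Opens.ext h)
  obtain ⟨x, hx, hx'⟩ := nonempty_inter_closedPoints hne U.isOpen.isLocallyClosed
  obtain ⟨t, ht, h⟩ := aux_pt K s x hx'
  exact ⟨t, ht, fun p ↦ by rw [h]; exact hx⟩

lemma aux_evzero (K : Type) [Field K] [IsAlgClosed K] {X : Scheme} [IsIntegral X]
    (s : X ⟶ Spec (CommRingCat.of K))
    [LocallyOfFiniteType s] (a : Γ(X, ⊤))
    (h : ∀ t : Spec (CommRingCat.of K) ⟶ X, t ≫ s = 𝟙 _ → t.appTop a = 0) : a = 0 := by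
  rw [← AlgebraicGeometry.basicOpen_eq_bot_iff]
  by_contra hb
  obtain ⟨t, ht, hU⟩ := aux_ptU K s _ hb
  let p : Spec (CommRingCat.of K) := (default : PrimeSpectrum K)
  have h1 : p ∈ t ⁻¹ᵁ (X.basicOpen a) := hU p
  rw [Scheme.preimage_basicOpen_top, h t ht, Scheme.basicOpen_zero] at h1
  exact h1

lemma aux_step2 (K : Type) [Field K] [IsAlgClosed K] {X : Scheme} [IsIntegral X]
    (s : X ⟶ Spec (CommRingCat.of K))
    [AlgebraicGeometry.IsSeparated s] [LocallyOfFiniteType s] [QuasiCompact s]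
    (α : pullback s s ⟶ X)
    (h1 : ∀ (t : Spec (CommRingCat.of K) ⟶ X) (ht : t ≫ s = 𝟙 _),
      IsIso (pullback.lift (𝟙 X) (s ≫ t) (by simp [ht]) ≫ α))
    (h2 : ∀ (u : Spec (CommRingCat.of K) ⟶ X) (_ : u ≫ s = 𝟙 _),
      ∃ (θ : X ⟶ X) (hθ : θ ≫ s = s), pullback.lift (𝟙 X) θ (by simp [hθ]) ≫ α = s ≫ u)
    (f : Γ(X, ⊤)) (hf : IsAffineOpen (X.basicOpen f)) (hf0 : X.basicOpen f ≠ ⊥) : IsAffine X := by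
  obtain ⟨S, hS⟩ := aux_sum (aux_fb K s s) (α.appTop f)
  let τ := fun t : {t : Spec (CommRingCat.of K) ⟶ X // t ≫ s = 𝟙 _} ↦
    pullback.lift (𝟙 X) (s ≫ t.1) (by simp [t.2]) ≫ α
  have hτ : ∀ t, IsIso (τ t) := fun t ↦ h1 t.1 t.2
  have key : ∀ t, (τ t).appTop f = ∑ p ∈ S, p.1 * s.appTop (t.1.appTop p.2) := by
    intro t
    simp only [τ, Scheme.Hom.comp_appTop, CommRingCat.comp_apply]
    rw [hS, map_sum]
    refine Finset.sum_congr rfl fun p _ ↦ ?_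
    rw [map_mul]
    change ((pullback.fst s s).appTop ≫ _).hom p.1 * ((pullback.snd s s).appTop ≫ _).hom p.2 = _
    rw [← Scheme.Hom.comp_appTop, ← Scheme.Hom.comp_appTop, pullback.lift_fst, pullback.lift_snd, Scheme.Hom.comp_appTop,
      Scheme.Hom.id_appTop]
    rfl
  let J : Ideal Γ(X, ⊤) := Ideal.span (Set.range fun t ↦ (τ t).appTop f)
  have hJ : J = ⊤ := by
    obtain ⟨u, hu, huU⟩ := aux_ptU K s _ hf0
    obtain ⟨θ, hθ, hθα⟩ := h2 u hu
    have hmem : ∑ p ∈ S, p.1 * θ.appTop.hom p.2 ∈ J := by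
      let := (aux_isField K).toField
      refine aux_alg s.appTop.hom
        (fun t : {t : Spec (CommRingCat.of K) ⟶ X // t ≫ s = 𝟙 _} ↦ t.1.appTop.hom)
        ?_ ?_ J S ?_ θ.appTop.hom ?_
      · intro t x
        have := congr(($(t.2)).appTop x)
        rw [Scheme.Hom.comp_appTop] at this
        simpa using this
      · intro a ha
        exact aux_evzero K s a fun t ht ↦ ha ⟨t, ht⟩
      · intro t
        exact Ideal.subset_span ⟨t, key t⟩
      · intro x
        have := congr(($(hθ)).appTop x)
        rw [Scheme.Hom.comp_appTop] at this
        simpa using this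
    have heq : ∑ p ∈ S, p.1 * θ.appTop.hom p.2 = s.appTop (u.appTop f) := by
      have := congr(($(hθα)).appTop f)
      simp only [Scheme.Hom.comp_appTop, CommRingCat.comp_apply] at this
      rw [← this, hS, map_sum]
      refine Finset.sum_congr rfl fun p _ ↦ ?_
      rw [map_mul]
      change _ = ((pullback.fst s s).appTop ≫ _).hom p.1 * ((pullback.snd s s).appTop ≫ _).hom p.2
      rw [← Scheme.Hom.comp_appTop, ← Scheme.Hom.comp_appTop, pullback.lift_fst, pullback.lift_snd]
      simp
    have hne : u.appTop f ≠ 0 := by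
      intro h0
      let p : Spec (CommRingCat.of K) := (default : PrimeSpectrum K)
      have h1 : p ∈ u ⁻¹ᵁ (X.basicOpen f) := huU p
      rw [Scheme.preimage_basicOpen_top, h0, Scheme.basicOpen_zero] at h1
      exact h1
    rw [heq] at hmem
    refine Ideal.eq_top_of_isUnit_mem _ hmem (IsUnit.map s.appTop.hom ?_)
    let := (aux_isField K).toField
    exact isUnit_iff_ne_zero.mpr hne
  refine isAffine_of_isAffineOpen_basicOpen _ hJ ?_
  rintro _ ⟨t, rfl⟩
  have := hτ t
  have h3 := hf.preimage_of_isIso (τ t)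
  rwa [Scheme.preimage_basicOpen_top] at h3

lemma aux_mem (K : Type) [Field K] {X : Scheme}
    (t : Spec (CommRingCat.of K) ⟶ X) (p : Spec (CommRingCat.of K)) (a : Γ(X, ⊤)) :
    t p ∈ X.basicOpen a ↔ t.appTop a ≠ 0 := by
  have h1 : t p ∈ X.basicOpen a ↔ p ∈ t ⁻¹ᵁ (X.basicOpen a) := Iff.rfl
  rw [h1, Scheme.preimage_basicOpen_top]
  constructor
  · intro h h0
    rw [h0, Scheme.basicOpen_zero] at h
    exact h
  · intro h
    have hu : IsUnit (t.appTop a) := by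
      let := (aux_isField K).toField
      exact isUnit_iff_ne_zero.mpr h
    rw [Scheme.basicOpen_of_isUnit _ hu]
    trivial

lemma aux_sep (K : Type) [Field K] {X : Scheme} (s : X ⟶ Spec (CommRingCat.of K))
    (x y : Spec (CommRingCat.of K) ⟶ X) (hx : x ≫ s = 𝟙 _) (hy : y ≫ s = 𝟙 _)
    (h : ∀ a, x.appTop a = 0 → y.appTop a = 0) : x.appTop = y.appTop := by
  have hx' : ∀ a, x.appTop (s.appTop a) = a := fun a ↦ by
    have := congr(($hx).appTop a)
    rw [Scheme.Hom.comp_appTop] at this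
    simpa using this
  have hy' : ∀ a, y.appTop (s.appTop a) = a := fun a ↦ by
    have := congr(($hy).appTop a)
    rw [Scheme.Hom.comp_appTop] at this
    simpa using this
  ext a
  have := h (a - s.appTop (x.appTop a)) (by rw [map_sub, hx', sub_self])
  rw [map_sub, hy', sub_eq_zero] at this
  exact this.symm

lemma aux_qf (K : Type) [Field K] [IsAlgClosed K] {X : Scheme}
    (s : X ⟶ Spec (CommRingCat.of K))
    [AlgebraicGeometry.IsSeparated s] [LocallyOfFiniteType s] [QuasiCompact s]
    (hsep : ∀ (x y : Spec (CommRingCat.of K) ⟶ X), x ≫ s = 𝟙 _ → y ≫ s = 𝟙 _ →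
      x.appTop = y.appTop → x = y) : X.IsQuasiAffine := by
  have hJ := LocallyOfFiniteType.jacobsonSpace s
  have : CompactSpace X := QuasiCompact.compactSpace_of_compactSpace s
  have : X.IsSeparated := Scheme.IsSeparated.mk (by
    rw [← terminal.comp_from s]; infer_instance)
  let f := X.toSpecΓ
  have hfs : f ≫ Spec.map s.appTop = s ≫ (Spec (CommRingCat.of K)).toSpecΓ :=
    (Scheme.toSpecΓ_naturality s).symm
  have hft : LocallyOfFiniteType f := by
    have : LocallyOfFiniteType (f ≫ Spec.map s.appTop) := by rw [hfs]; infer_instance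
    exact locallyOfFiniteType_of_comp f (Spec.map s.appTop)
  have hfsep : AlgebraicGeometry.IsSeparated f := inferInstance
  have hfqc : QuasiCompact f := inferInstance
  have hinj : ∀ x y : X, IsClosed {x} → f y = f x → y = x := by
    intro x y hx hy
    by_contra hne
    let Z : Set X := f ⁻¹' (closure {f x})
    have hZ : IsClosed Z := isClosed_closure.preimage f.continuous
    have hyZ : y ∈ Z := by
      change f y ∈ closure {f x}
      rw [hy]; exact subset_closure rfl
    obtain ⟨w, hw, hw'⟩ := nonempty_inter_closedPoints (Z := Z ∩ {x}ᶜ) ⟨y, hyZ, hne⟩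
      (hZ.isLocallyClosed.inter hx.isOpen_compl.isLocallyClosed)
    obtain ⟨tx, htx, htx'⟩ := aux_pt K s x hx
    obtain ⟨tw, htw, htw'⟩ := aux_pt K s w hw'
    let p : Spec (CommRingCat.of K) := (default : PrimeSpectrum K)
    apply hw.2
    have heq : tx = tw := by
      apply hsep _ _ htx htw
      apply aux_sep K s _ _ htx htw
      intro a ha
      by_contra hna
      rw [← ne_eq, ← aux_mem K tw p, htw', ← Scheme.toSpecΓ_preimage_basicOpen] at hna
      have h1 : f x ∈ PrimeSpectrum.basicOpen a := by
        have h2 : f w ∈ closure {f x} := hw.1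
        rw [mem_closure_iff] at h2
        obtain ⟨q, hq, rfl⟩ := h2 _ (PrimeSpectrum.basicOpen a).isOpen hna
        exact hq
      have h3 : x ∈ f ⁻¹ᵁ (PrimeSpectrum.basicOpen a) := h1
      rw [Scheme.toSpecΓ_preimage_basicOpen, ← htx' p, aux_mem] at h3
      exact h3 ha
    rw [← htw' p, ← heq, htx']
    rfl
  have hcl : ∀ x : X, IsClosed {x} → x ∈ f.quasiFiniteLocus := by
    intro x hx
    rw [Scheme.Hom.mem_quasiFiniteLocus, Scheme.Hom.quasiFiniteAt_iff_isOpen_singleton_asFiber]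
    convert isOpen_univ
    ext w
    simp only [Set.mem_singleton_iff, Set.mem_univ, iff_true]
    apply (f.fiberι (f x)).isEmbedding.injective
    rw [Scheme.Hom.fiberι_asFiber]
    apply hinj x _ hx
    exact (f.fiberHomeo (f x) w).2
  have htop : f.quasiFiniteLocus = ⊤ := by
    by_contra hne
    have hne' : ((f.quasiFiniteLocus : Set X)ᶜ).Nonempty := by
      rw [Set.nonempty_compl]
      intro h
      exact hne (TopologicalSpace.Opens.ext h)
    obtain ⟨w, hw, hw'⟩ := nonempty_inter_closedPoints hne'
      f.quasiFiniteLocus.isOpen.isClosed_compl.isLocallyClosed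
    exact hw (hcl w hw')
  have : LocallyQuasiFinite f := (f.quasiFiniteLocus_eq_top_iff).mp htop
  have : IsAffine f.normalization := isAffine_of_isAffineHom f.fromNormalization
  exact Scheme.IsQuasiAffine.of_isImmersion f.toNormalization

lemma aux_comp_ptOp {X S : Scheme} (s : X ⟶ S) (μ : pullback s s ⟶ X)
    {T T' : Scheme} (r : T' ⟶ T) (x y : T ⟶ X) (h : x ≫ s = y ≫ s) :
    r ≫ ptOp s μ x y h = ptOp s μ (r ≫ x) (r ≫ y) (by simp [h]) := by
  unfold ptOp
  rw [← Category.assoc]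
  congr 1
  apply pullback.hom_ext
  · rw [Category.assoc, pullback.lift_fst, pullback.lift_fst]
  · rw [Category.assoc, pullback.lift_snd, pullback.lift_snd]

lemma aux_ptOp_congr {X S : Scheme} (s : X ⟶ S) (μ : pullback s s ⟶ X)
    {T : Scheme} {x y x' y' : T ⟶ X} (h : x ≫ s = y ≫ s) (hx : x = x') (hy : y = y') :
    ptOp s μ x y h = ptOp s μ x' y' (by rw [← hx, ← hy, h]) := by
  subst hx hy; rfl

lemma aux_ptOp_s {X S : Scheme} (s : X ⟶ S) (μ : pullback s s ⟶ X)
    (hμ : μ ≫ s = pullback.fst s s ≫ s)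
    {T : Scheme} (x y : T ⟶ X) (h : x ≫ s = y ≫ s) :
    ptOp s μ x y h ≫ s = x ≫ s := by
  rw [ptOp, Category.assoc, hμ, pullback.lift_fst_assoc]

lemma aux_L0 {X S : Scheme} [Subsingleton S] (s : X ⟶ S) [AlgebraicGeometry.IsSeparated s] (z : S ⟶ X)
    (hz : z ≫ s = 𝟙 _) {T : Scheme} [IsReduced T] (h : T ⟶ X) (hh : ∀ p, h p ∈ Set.range z) :
    h = h ≫ s ≫ z := by
  have : IsClosedImmersion z := by
    exact isClosedImmersion_of_comp_eq_id s z hz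
  have : Surjective (pullback.fst h z) := by
    refine ⟨fun p ↦ ?_⟩
    obtain ⟨q, hq⟩ := hh p
    obtain ⟨r, hr, -⟩ := Scheme.Pullback.exists_preimage_pullback (f := h) (g := z) p q hq.symm
    exact ⟨r, hr⟩
  have := isIso_of_isClosedImmersion_of_surjective (pullback.fst h z)
  have key : h = (inv (pullback.fst h z) ≫ pullback.snd h z) ≫ z := by
    rw [Category.assoc, ← pullback.condition]; simp
  rw [key]
  simp only [Category.assoc]
  rw [reassoc_of% hz]

lemma aux_L1 {X S : Scheme} [Subsingleton S] (s : X ⟶ S) [AlgebraicGeometry.IsSeparated s] (z : S ⟶ X)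
    (hz : z ≫ s = 𝟙 _) (μ : pullback s s ⟶ X)
    (hmz : ∀ (T : Scheme) (x : T ⟶ X) (h : x ≫ s = (x ≫ s ≫ z) ≫ s),
      ptOp s μ x (x ≫ s ≫ z) h = x ≫ s ≫ z) (o : S)
    {P : Scheme} (a b : P ⟶ X) (h : a ≫ s = b ≫ s) (hb : ∀ p, b p = z o) (p : P) :
    ptOp s μ a b h p = z o := by
  let r := P.fromSpecResidueField p
  have h1 : r ≫ b = (r ≫ a) ≫ s ≫ z := by
    rw [aux_L0 s z hz (r ≫ b) (fun q ↦ ⟨o, by simp [hb]⟩)]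
    simp [reassoc_of% h]
  have h2 : r ≫ ptOp s μ a b h = (r ≫ a) ≫ s ≫ z := by
    rw [aux_comp_ptOp, aux_ptOp_congr s μ _ rfl h1, hmz]
  let q : Spec (P.residueField p) := (default : PrimeSpectrum _)
  have h3 : r q = p := Scheme.fromSpecResidueField_apply _ _
  rw [← h3, ← Scheme.Hom.comp_apply, h2]
  simp only [Scheme.Hom.comp_apply]
  congr 1
  exact Subsingleton.elim _ _

lemma aux_L2 (K : Type) [Field K] {X : Scheme} (s : X ⟶ Spec (CommRingCat.of K))
    [AlgebraicGeometry.IsSeparated s] [QuasiCompact s] (z : Spec (CommRingCat.of K) ⟶ X)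
    (hz : z ≫ s = 𝟙 _) (μ : pullback s s ⟶ X)
    (hmz : ∀ (T : Scheme) (x : T ⟶ X) (h : x ≫ s = (x ≫ s ≫ z) ≫ s),
      ptOp s μ x (x ≫ s ≫ z) h = x ≫ s ≫ z) (o : Spec (CommRingCat.of K))
    (x y : Spec (CommRingCat.of K) ⟶ X) (hx : x ≫ s = 𝟙 _) (hy : y ≫ s = 𝟙 _)
    (hxy : x.appTop = y.appTop) {T : Scheme} [IsAffine T] (i : T ⟶ X) (hi : ∀ p, i p = z o) :
    ptOp s μ (i ≫ s ≫ x) i (by simp [hx]) = ptOp s μ (i ≫ s ≫ y) i (by simp [hy]) := by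
  have : Subsingleton (Spec (CommRingCat.of K)) :=
    inferInstanceAs (Subsingleton (PrimeSpectrum K))
  let M := ptOp s μ (pullback.fst s (i ≫ s)) (pullback.snd s (i ≫ s) ≫ i)
    (by simp [pullback.condition])
  have hM : ∀ p, M p = z o := fun p ↦ aux_L1 s z hz μ hmz o _ _ _ (fun p ↦ by simp [hi]) p
  obtain ⟨U, hU, hzU⟩ : ∃ U : X.Opens, IsAffineOpen U ∧ z o ∈ U := by
    obtain ⟨_, ⟨U, hU, rfl⟩, hzU, -⟩ :=
      X.isBasis_affineOpens.exists_subset_of_mem_open (Set.mem_univ (z o)) isOpen_univ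
    exact ⟨U, hU, hzU⟩
  have : IsAffine U := hU
  let M' := IsOpenImmersion.lift U.ι M (by
    rintro _ ⟨p, rfl⟩
    rw [hM]; simpa using hzU)
  have hM' : M' ≫ U.ι = M := IsOpenImmersion.lift_fac _ _ _
  let σ := fun (x : Spec (CommRingCat.of K) ⟶ X) (hx : x ≫ s = 𝟙 _) ↦
    pullback.lift (f := s) (g := i ≫ s) (i ≫ s ≫ x) (𝟙 T) (by simp [hx])
  have hσM : ∀ x hx, σ x hx ≫ M = ptOp s μ (i ≫ s ≫ x) i (by simp [hx]) := by
    intro x hx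
    simp only [M]
    rw [aux_comp_ptOp]
    apply aux_ptOp_congr
    · rw [pullback.lift_fst]
    · rw [pullback.lift_snd_assoc, Category.id_comp]
  have hσ : (σ x hx).appTop = (σ y hy).appTop := by
    apply (aux_fb K s (i ≫ s)).hom_ext
    · rw [← Scheme.Hom.comp_appTop, ← Scheme.Hom.comp_appTop, pullback.lift_fst, pullback.lift_fst]
      simp only [Scheme.Hom.comp_appTop, hxy]
    · rw [← Scheme.Hom.comp_appTop, ← Scheme.Hom.comp_appTop, pullback.lift_snd, pullback.lift_snd]
  have h1 : σ x hx ≫ M' = σ y hy ≫ M' := by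
    apply ext_of_isAffine
    rw [Scheme.Hom.comp_appTop, Scheme.Hom.comp_appTop, hσ]
  rw [← hσM x hx, ← hσM y hy, ← hM', reassoc_of% h1]

lemma aux_L3 (K : Type) [Field K] {X : Scheme} (s : X ⟶ Spec (CommRingCat.of K))
    [AlgebraicGeometry.IsSeparated s] [LocallyOfFiniteType s]
    [QuasiCompact s] (z : Spec (CommRingCat.of K) ⟶ X)
    (hz : z ≫ s = 𝟙 _) (μ : pullback s s ⟶ X)
    (hmz : ∀ (T : Scheme) (x : T ⟶ X) (h : x ≫ s = (x ≫ s ≫ z) ≫ s),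
      ptOp s μ x (x ≫ s ≫ z) h = x ≫ s ≫ z) (o : Spec (CommRingCat.of K))
    (x y : Spec (CommRingCat.of K) ⟶ X) (hx : x ≫ s = 𝟙 _) (hy : y ≫ s = 𝟙 _)
    (hxy : x.appTop = y.appTop) :
    X.fromSpecStalk (z o) ≫ ptOp s μ (s ≫ x) (𝟙 X) (by simp [hx]) =
      X.fromSpecStalk (z o) ≫ ptOp s μ (s ≫ y) (𝟙 X) (by simp [hy]) := by
  have : Subsingleton (Spec (CommRingCat.of K)) :=
    inferInstanceAs (Subsingleton (PrimeSpectrum K))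
  have : IsLocallyNoetherian X := LocallyOfFiniteType.isLocallyNoetherian s
  obtain ⟨U, hU, hzU⟩ : ∃ U : X.Opens, IsAffineOpen U ∧ z o ∈ U := by
    obtain ⟨_, ⟨U, hU, rfl⟩, hzU, -⟩ :=
      X.isBasis_affineOpens.exists_subset_of_mem_open (Set.mem_univ (z o)) isOpen_univ
    exact ⟨U, hU, hzU⟩
  have : IsAffine U := hU
  let O := X.presheaf.stalk (z o)
  let j : Spec O ⟶ X := X.fromSpecStalk (z o)
  let m := IsLocalRing.maximalIdeal O
  let q (n : ℕ) : O ⟶ CommRingCat.of (O ⧸ m ^ (n + 1)) :=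
    CommRingCat.ofHom (Ideal.Quotient.mk (m ^ (n + 1)))
  have hq : ∀ n p, Spec.map (q n) p = IsLocalRing.closedPoint O := by
    intro n p
    apply PrimeSpectrum.ext
    refine (IsLocalRing.eq_maximalIdeal ?_)
    change ((PrimeSpectrum.comap (q n).hom p).asIdeal).IsMaximal
    have h1 : m ≤ (PrimeSpectrum.comap (q n).hom p).asIdeal := by
      refine Ideal.IsPrime.le_of_pow_le (n := n + 1) ?_
      intro a ha
      have h0 : (q n).hom a = 0 := Ideal.Quotient.eq_zero_iff_mem.mpr ha
      change (q n).hom a ∈ p.asIdeal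
      rw [h0]; exact zero_mem _
    have h2 : m = _ := (IsLocalRing.maximalIdeal.isMaximal O).eq_of_le
      (PrimeSpectrum.comap (q n).hom p).isPrime.ne_top h1
    rw [← h2]
    exact IsLocalRing.maximalIdeal.isMaximal O
  have hj : j (IsLocalRing.closedPoint O) = z o := Scheme.fromSpecStalk_closedPoint
  have hi : ∀ n p, (Spec.map (q n) ≫ j) p = z o := by
    intro n p
    rw [Scheme.Hom.comp_apply, hq, hj]
  have key : ∀ (x : Spec (CommRingCat.of K) ⟶ X) (hx : x ≫ s = 𝟙 _),
      ∃ g : Spec O ⟶ U, g ≫ U.ι = j ≫ ptOp s μ (s ≫ x) (𝟙 X) (by simp [hx]) := by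
    intro x hx
    set G := j ≫ ptOp s μ (s ≫ x) (𝟙 X) (by simp [hx]) with hG
    have hcl : G (IsLocalRing.closedPoint O) = z o := by
      let r : O ⟶ CommRingCat.of (IsLocalRing.ResidueField O) :=
        CommRingCat.ofHom (IsLocalRing.residue O)
      let p : Spec (CommRingCat.of (IsLocalRing.ResidueField O)) :=
        (default : PrimeSpectrum (IsLocalRing.ResidueField O))
      have hp : ∀ p, Spec.map r p = IsLocalRing.closedPoint O :=
        fun p ↦ IsLocalRing.PrimeSpectrum.comap_residue O p
      rw [← hp p, ← Scheme.Hom.comp_apply, hG, aux_comp_ptOp, aux_comp_ptOp]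
      apply aux_L1 s z hz μ hmz o
      intro p
      rw [Category.comp_id, Scheme.Hom.comp_apply, hp]
      exact hj
    have htop : G ⁻¹ᵁ U = ⊤ := by
      apply Scheme.preimage_eq_top_of_closedPoint_mem
      rw [hcl]; exact hzU
    refine ⟨IsOpenImmersion.lift U.ι G ?_, IsOpenImmersion.lift_fac _ _ _⟩
    rintro _ ⟨p, rfl⟩
    have : p ∈ G ⁻¹ᵁ U := by rw [htop]; trivial
    simpa using this
  obtain ⟨gx, hgx⟩ := key x hx
  obtain ⟨gy, hgy⟩ := key y hy
  change j ≫ _ = j ≫ _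
  rw [← hgx, ← hgy]
  congr 1
  have hag : ∀ n, Spec.map (q n) ≫ gx = Spec.map (q n) ≫ gy := by
    intro n
    rw [← cancel_mono U.ι, Category.assoc, Category.assoc, hgx, hgy]
    have := aux_L2 K s z hz μ hmz o x y hx hy hxy (Spec.map (q n) ≫ j) (hi n)
    rw [aux_comp_ptOp, aux_comp_ptOp, aux_comp_ptOp, aux_comp_ptOp]
    refine Eq.trans ?_ (this.trans ?_)
    · apply aux_ptOp_congr <;> simp
    · apply aux_ptOp_congr <;> simp
  apply ext_of_isAffine
  ext b
  rw [← sub_eq_zero]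
  set d := gx.appTop.hom b - gy.appTop.hom b with hd
  have hd0 : ∀ n, (Spec.map (q n)).appTop.hom d = 0 := by
    intro n
    rw [hd, map_sub, sub_eq_zero]
    have := congr(($(hag n)).appTop.hom b)
    simpa only [Scheme.Hom.comp_appTop, CommRingCat.hom_comp, RingHom.comp_apply] using this
  have hd1 : ∀ n, (Scheme.ΓSpecIso O).hom.hom d ∈ m ^ (n + 1) := by
    intro n
    have := congr(($(Scheme.ΓSpecIso_naturality (q n))).hom d)
    rw [CommRingCat.hom_comp, RingHom.comp_apply, hd0, map_zero] at this
    exact Ideal.Quotient.eq_zero_iff_mem.mp this.symm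
  have hd2 : (Scheme.ΓSpecIso O).hom.hom d = 0 := by
    have hmem : (Scheme.ΓSpecIso O).hom.hom d ∈ (⨅ i : ℕ, m ^ i) := by
      rw [Ideal.mem_iInf]
      intro n
      exact Ideal.pow_le_pow_right (Nat.le_succ n) (hd1 n)
    rw [Ideal.iInf_pow_eq_bot_of_isLocalRing m (IsLocalRing.maximalIdeal.isMaximal O).ne_top] at hmem
    exact hmem
  exact (Scheme.ΓSpecIso O).commRingCatIsoToRingEquiv.injective (hd2.trans (map_zero _).symm)

lemma aux_step1 (K : Type) [Field K] {X : Scheme} [IsIntegral X] (s : X ⟶ Spec (CommRingCat.of K))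
    [AlgebraicGeometry.IsSeparated s] [LocallyOfFiniteType s]
    [QuasiCompact s] (z : Spec (CommRingCat.of K) ⟶ X)
    (hz : z ≫ s = 𝟙 _) (μ : pullback s s ⟶ X) (hμ : μ ≫ s = pullback.fst s s ≫ s)
    (hmz : ∀ (T : Scheme) (x : T ⟶ X) (h : x ≫ s = (x ≫ s ≫ z) ≫ s),
      ptOp s μ x (x ≫ s ≫ z) h = x ≫ s ≫ z)
    (e : Spec (CommRingCat.of K) ⟶ X) (he : e ≫ s = 𝟙 _)
    (hmul_one : ∀ (T : Scheme) (x : T ⟶ X) (h : x ≫ s = (x ≫ s ≫ e) ≫ s),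
      ptOp s μ x (x ≫ s ≫ e) h = x)
    (x y : Spec (CommRingCat.of K) ⟶ X) (hx : x ≫ s = 𝟙 _) (hy : y ≫ s = 𝟙 _)
    (hxy : x.appTop = y.appTop) : x = y := by
  let o : Spec (CommRingCat.of K) := (default : PrimeSpectrum K)
  have hdom : IsDominant (X.fromSpecStalk (z o)) := by
    constructor
    have h1 : genericPoint X ∈ Set.range (X.fromSpecStalk (z o)) := by
      rw [Scheme.range_fromSpecStalk]
      exact genericPoint_specializes _
    rw [DenseRange, dense_iff_closure_eq, Set.eq_univ_iff_forall]
    intro w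
    exact closure_mono (Set.singleton_subset_iff.mpr h1)
      (by rw [genericPoint_closure]; trivial)
  have hl : ptOp s μ (s ≫ x) (𝟙 X) (by simp [hx]) = ptOp s μ (s ≫ y) (𝟙 X) (by simp [hy]) := by
    refine ext_of_isDominant_of_isSeparated s ?_ (X.fromSpecStalk (z o))
      (aux_L3 K s z hz μ hmz o x y hx hy hxy)
    rw [aux_ptOp_s s μ hμ, aux_ptOp_s s μ hμ, Category.assoc, Category.assoc, hx, hy]
  have hfin : ∀ (x : Spec (CommRingCat.of K) ⟶ X) (hx : x ≫ s = 𝟙 _),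
      e ≫ ptOp s μ (s ≫ x) (𝟙 X) (by simp [hx]) = x := by
    intro x hx
    rw [aux_comp_ptOp]
    refine Eq.trans ?_ (hmul_one _ x (by simp [reassoc_of% hx, he, hx]))
    apply aux_ptOp_congr
    · rw [reassoc_of% he]
    · rw [reassoc_of% hx, Category.comp_id]
  rw [← hfin x hx, ← hfin y hy, hl]

/-- Let `X` be an irreducible variety over an algebraically closed field
`K` equipped with morphisms `α, μ : X ×_K X ⟶ X` satisfying all the algebraic-ring
axioms (I)–(IV) (commutative algebraic group `(X, α)` with zero section `z` and
inversion `ι`; associative `μ`; two-sided distributivity; and a multiplicative identity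
section `e`), expressed on `T`-valued points for arbitrary schemes `T`.  Then the
underlying variety `X` is affine. -/
theorem stmt_17 (K : Type) [Field K] [IsAlgClosed K]
    (X : Scheme) [IsIntegral X]
    (s : X ⟶ Spec (CommRingCat.of K))
    [AlgebraicGeometry.IsSeparated s] [LocallyOfFiniteType s] [QuasiCompact s]
    (α μ : pullback s s ⟶ X)
    (z : Spec (CommRingCat.of K) ⟶ X) (ι : X ⟶ X)
    (e : Spec (CommRingCat.of K) ⟶ X)
    (hα : α ≫ s = pullback.fst s s ≫ s)
    (hμ : μ ≫ s = pullback.fst s s ≫ s)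
    (hz : z ≫ s = 𝟙 _) (hι : ι ≫ s = s) (he : e ≫ s = 𝟙 _)
    -- (I) `(X, α)` is a commutative algebraic group over `K`:
    (hcomm : ∀ (T : Scheme) (x y : T ⟶ X) (h : x ≫ s = y ≫ s),
      ptOp s α x y h = ptOp s α y x h.symm)
    (haddassoc : ∀ (T : Scheme) (x y w : T ⟶ X)
      (hxy : x ≫ s = y ≫ s) (hyw : y ≫ s = w ≫ s)
      (h1 : ptOp s α x y hxy ≫ s = w ≫ s)
      (h2 : x ≫ s = ptOp s α y w hyw ≫ s),
      ptOp s α (ptOp s α x y hxy) w h1 = ptOp s α x (ptOp s α y w hyw) h2)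
    (hzero : ∀ (T : Scheme) (x : T ⟶ X) (h : (x ≫ s ≫ z) ≫ s = x ≫ s),
      ptOp s α (x ≫ s ≫ z) x h = x)
    (hneg : ∀ (T : Scheme) (x : T ⟶ X) (h : (x ≫ ι) ≫ s = x ≫ s),
      ptOp s α (x ≫ ι) x h = x ≫ s ≫ z)
    -- (II) associativity of `μ`:
    (hmulassoc : ∀ (T : Scheme) (x y w : T ⟶ X)
      (hxy : x ≫ s = y ≫ s) (hyw : y ≫ s = w ≫ s)
      (h1 : ptOp s μ x y hxy ≫ s = w ≫ s)
      (h2 : x ≫ s = ptOp s μ y w hyw ≫ s),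
      ptOp s μ (ptOp s μ x y hxy) w h1 = ptOp s μ x (ptOp s μ y w hyw) h2)
    -- (III) distributivity of `μ` over `α` on both sides:
    (hldistrib : ∀ (T : Scheme) (x y w : T ⟶ X)
      (hyw : y ≫ s = w ≫ s) (hxy : x ≫ s = y ≫ s) (hxw : x ≫ s = w ≫ s)
      (h1 : x ≫ s = ptOp s α y w hyw ≫ s)
      (h2 : ptOp s μ x y hxy ≫ s = ptOp s μ x w hxw ≫ s),
      ptOp s μ x (ptOp s α y w hyw) h1 =
        ptOp s α (ptOp s μ x y hxy) (ptOp s μ x w hxw) h2)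
    (hrdistrib : ∀ (T : Scheme) (x y w : T ⟶ X)
      (hxy : x ≫ s = y ≫ s) (hxw : x ≫ s = w ≫ s) (hyw : y ≫ s = w ≫ s)
      (h1 : ptOp s α x y hxy ≫ s = w ≫ s)
      (h2 : ptOp s μ x w hxw ≫ s = ptOp s μ y w hyw ≫ s),
      ptOp s μ (ptOp s α x y hxy) w h1 =
        ptOp s α (ptOp s μ x w hxw) (ptOp s μ y w hyw) h2)
    -- (IV) `e` is a two-sided multiplicative identity:
    (hone_mul : ∀ (T : Scheme) (x : T ⟶ X) (h : (x ≫ s ≫ e) ≫ s = x ≫ s),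
      ptOp s μ (x ≫ s ≫ e) x h = x)
    (hmul_one : ∀ (T : Scheme) (x : T ⟶ X) (h : x ≫ s = (x ≫ s ≫ e) ≫ s),
      ptOp s μ x (x ≫ s ≫ e) h = x) :
    IsAffine X := by
  have hS := @aux_ptOp_s X _ s α hα
  have hzs : ∀ (T : Scheme) (x : T ⟶ X), (x ≫ s ≫ z) ≫ s = x ≫ s := fun T x ↦ by simp [hz]
  have his : ∀ (T : Scheme) (x : T ⟶ X), (x ≫ ι) ≫ s = x ≫ s := fun T x ↦ by simp [hι]
  have hzero' : ∀ (T : Scheme) (x y : T ⟶ X) (h : x ≫ s = (y ≫ s ≫ z) ≫ s),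
      ptOp s α x (y ≫ s ≫ z) h = x := by
    intro T x y h
    have hxy : x ≫ s = y ≫ s := h.trans (hzs T y)
    rw [hcomm]
    refine Eq.trans ?_ (hzero T x (hzs T x))
    apply aux_ptOp_congr
    · rw [← Category.assoc, ← Category.assoc, hxy]
    · rfl
  have hA2 : ∀ (T : Scheme) (x y : T ⟶ X) (h : x ≫ s = (y ≫ ι) ≫ s)
      (h' : ptOp s α x (y ≫ ι) h ≫ s = y ≫ s), ptOp s α (ptOp s α x (y ≫ ι) h) y h' = x := by
    intro T x y h h'
    have hn := hneg T y (his T y)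
    rw [haddassoc T x (y ≫ ι) y h (his T y) h' (by rw [hn, hzs, h, his])]
    rw [aux_ptOp_congr s α _ rfl hn]
    exact hzero' T x y _
  have hA1 : ∀ (T : Scheme) (x y : T ⟶ X) (h : x ≫ s = y ≫ s)
      (h' : ptOp s α x y h ≫ s = (y ≫ ι) ≫ s), ptOp s α (ptOp s α x y h) (y ≫ ι) h' = x := by
    intro T x y h h'
    have hn : ptOp s α y (y ≫ ι) (his T y).symm = y ≫ s ≫ z := by
      rw [hcomm]; exact hneg T y (his T y)
    rw [haddassoc T x y (y ≫ ι) h (his T y).symm h' (by rw [hn, hzs, h])]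
    rw [aux_ptOp_congr s α _ rfl hn]
    exact hzero' T x y _
  have hmz : ∀ (T : Scheme) (x : T ⟶ X) (h : x ≫ s = (x ≫ s ≫ z) ≫ s),
      ptOp s μ x (x ≫ s ≫ z) h = x ≫ s ≫ z := by
    intro T x h
    have hw : ptOp s μ x (x ≫ s ≫ z) h ≫ s = x ≫ s := aux_ptOp_s s μ hμ _ _ _
    have h0 : ptOp s α (x ≫ s ≫ z) (x ≫ s ≫ z) rfl = x ≫ s ≫ z := hzero' T _ x _
    have h1 := hldistrib T x (x ≫ s ≫ z) (x ≫ s ≫ z) rfl h h (by rw [h0]; exact h) rfl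
    rw [aux_ptOp_congr s μ _ rfl h0] at h1
    generalize ptOp s μ x (x ≫ s ≫ z) h = w at hw h1
    have h2 := hA1 T w w rfl (by rw [← h1]; exact (his T w).symm)
    rw [aux_ptOp_congr s α _ h1.symm rfl, hcomm, hneg T w (his T w)] at h2
    rw [← h2, ← Category.assoc, hw, Category.assoc]
  have hsep := fun x y hx hy hxy ↦ aux_step1 K s z hz μ hμ hmz e he hmul_one x y hx hy hxy
  have hqa : X.IsQuasiAffine := aux_qf K s hsep
  obtain ⟨f, hf, hf0⟩ : ∃ f : Γ(X, ⊤), IsAffineOpen (X.basicOpen f) ∧ X.basicOpen f ≠ ⊥ := by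
    obtain ⟨_, ⟨_, ⟨r, hr, rfl⟩, rfl⟩, hxr, -⟩ := (Scheme.IsQuasiAffine.isBasis_basicOpen
      X).exists_subset_of_mem_open (Set.mem_univ (genericPoint X)) isOpen_univ
    refine ⟨r, hr, fun h ↦ ?_⟩
    rw [h] at hxr
    exact hxr
  refine aux_step2 K s α ?_ ?_ f hf hf0
  · intro t ht
    have hti : (t ≫ ι) ≫ s = 𝟙 _ := by rw [his, ht]
    have e1 : (𝟙 X : X ⟶ X) ≫ s = (s ≫ t) ≫ s := by simp [ht]
    have e2 : (𝟙 X : X ⟶ X) ≫ s = ((s ≫ t) ≫ ι) ≫ s := by rw [his, ← e1]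
    change IsIso (ptOp s α (𝟙 X) (s ≫ t) e1)
    refine ⟨ptOp s α (𝟙 X) ((s ≫ t) ≫ ι) e2, ?_, ?_⟩
    · rw [aux_comp_ptOp]
      refine Eq.trans ?_ (hA1 X (𝟙 X) (s ≫ t) e1 (by rw [hS, e1, his]))
      apply aux_ptOp_congr
      · rw [Category.comp_id]
      · rw [← Category.assoc, ← Category.assoc, hS, Category.id_comp]
    · rw [aux_comp_ptOp]
      refine Eq.trans ?_ (hA2 X (𝟙 X) (s ≫ t) e2 (by rw [hS, e1]))
      apply aux_ptOp_congr
      · rw [Category.comp_id]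
      · rw [← Category.assoc, hS, Category.id_comp]
  · intro u hu
    have e1 : (s ≫ u) ≫ s = (𝟙 X ≫ ι) ≫ s := by simp [hu, hι]
    have e2 : ptOp s α (s ≫ u) (𝟙 X ≫ ι) e1 ≫ s = s := by rw [hS]; simp [hu]
    refine ⟨ptOp s α (s ≫ u) (𝟙 X ≫ ι) e1, e2, ?_⟩
    change ptOp s α (𝟙 X) (ptOp s α (s ≫ u) (𝟙 X ≫ ι) e1) _ = _
    rw [hcomm]
    exact hA2 X (s ≫ u) (𝟙 X) e1 _
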